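/- Let n ≥ 2. There exists a finite generating set Σ of T_n with n+1 elements, containing c_0, such that for all integers k ≥ 1 and ℓ with 0 < ℓ < k(n−1)+1, the word length of c_k^ℓ with respect to Σ satisfies |c_k^ℓ|_Σ < 3k + n. -/

import Mathlib

noncomputable section

namespace ThompsonPaper

/-- The circle `ℝ/ℤ`. -/
abbrev Circle : Type := AddCircle (1 : ℝ)

/-- Homeomorphisms of a topological space form a group under composition,
with `(f * g) x = f (g x)`. -/
instance homeoGroup {α : Type*} [TopologicalSpace α] : Group (α ≃ₜ α) where
  mul f g := g.trans f
  one := Homeomorph.refl α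
  inv := Homeomorph.symm
  mul_assoc _ _ _ := Homeomorph.ext fun _ => rfl
  one_mul _ := Homeomorph.ext fun _ => rfl
  mul_one _ := Homeomorph.ext fun _ => rfl
  inv_mul_cancel f := Homeomorph.ext fun x => f.symm_apply_apply x

/-- `x` is an `n`-adic rational: `x = a / n ^ k` with `a` an integer, `k` a natural number. -/
def IsNAdic (n : ℕ) (x : ℝ) : Prop := ∃ a : ℤ, ∃ k : ℕ, x = (a : ℝ) / (n : ℝ) ^ k

/-- The set of `n`-adic points of the circle. -/
def nAdicPoints (n : ℕ) : Set Circle := { p | ∃ x : ℝ, IsNAdic n x ∧ p = (x : Circle) }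

/-- `F : ℝ → ℝ` is a lift of the circle map `f`. -/
def IsLift (f : Circle ≃ₜ Circle) (F : ℝ → ℝ) : Prop :=
  ∀ x : ℝ, f (x : Circle) = ((F x : ℝ) : Circle)

/-- `F : ℝ → ℝ` commutes with translation by `1` and is piecewise affine with finitely
many breakpoints (modulo `1`), all breakpoints at `n`-adic rationals, and with the slope
of every affine piece an integer power of `n`. -/
def PiecewiseNAffine (n : ℕ) (F : ℝ → ℝ) : Prop :=
  (∀ x : ℝ, F (x + 1) = F x + 1) ∧
  ∃ m : ℕ, ∃ t : ℕ → ℝ, ∃ slope : ℕ → ℤ, ∃ c : ℕ → ℝ,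
    0 < m ∧ t 0 = 0 ∧ t m = 1 ∧
    (∀ i, i < m → t i < t (i + 1)) ∧
    (∀ i, i ≤ m → IsNAdic n (t i)) ∧
    (∀ i, i < m → ∀ x ∈ Set.Icc (t i) (t (i + 1)),
      F x = (n : ℝ) ^ (slope i) * x + c i)

/-- Membership in Thompson's group `T_n`: an orientation-preserving homeomorphism of the
circle `ℝ/ℤ` mapping the set of `n`-adic points onto itself, which is piecewise affine
with finitely many breakpoints, all breakpoints at `n`-adic points, and all slopes integer
powers of `n`.  (Orientation preservation and the piecewise affine structure are expressed
through a strictly increasing lift.) -/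
def InT (n : ℕ) (f : Circle ≃ₜ Circle) : Prop :=
  f '' nAdicPoints n = nAdicPoints n ∧
  ∃ F : ℝ → ℝ, StrictMono F ∧ IsLift f F ∧ PiecewiseNAffine n F

/-- Thompson's group `T_n`, as a set of circle homeomorphisms. -/
def TnSet (n : ℕ) : Set (Circle ≃ₜ Circle) := { f | InT n f }

/-- Thompson's group `T_n`, as a subgroup of the homeomorphism group of the circle.
(The set `TnSet n` is closed under the group operations, so this subgroup has exactly
`TnSet n` as its underlying set.) -/
def Tn (n : ℕ) : Subgroup (Circle ≃ₜ Circle) := Subgroup.closure (TnSet n)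

/-- The left endpoints of the standard `n`-adic subdivision `P_k` obtained by `k+1`
subdivision steps, each applied to the rightmost interval, listed in increasing order;
the index `j = (k+1)*(n-1)+1` gives the final right endpoint `1`. -/
def ckPt (n k j : ℕ) : ℝ :=
  if j = (k + 1) * (n - 1) + 1 then 1
  else (1 - (n : ℝ) ^ (-(j / (n - 1) : ℕ) : ℤ)) +
    (j % (n - 1) : ℕ) * (n : ℝ) ^ (-((j / (n - 1) : ℕ) + 1 : ℕ) : ℤ)

/-- `f` is the element `c_k` of `T_n`: writing `m = (k+1)(n-1)+1` and
`I_0, …, I_{m-1}` for the intervals of the standard subdivision `P_k`, `f` maps each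
`I_j` affinely onto `I_{(j+1) mod m}`. -/
def IsCk (n k : ℕ) (f : Circle ≃ₜ Circle) : Prop :=
  ∀ j < (k + 1) * (n - 1) + 1, ∀ x ∈ Set.Icc (ckPt n k j) (ckPt n k (j + 1)),
    f (x : Circle) =
      ((ckPt n k ((j + 1) % ((k + 1) * (n - 1) + 1)) +
        (ckPt n k ((j + 1) % ((k + 1) * (n - 1) + 1) + 1) -
          ckPt n k ((j + 1) % ((k + 1) * (n - 1) + 1))) /
          (ckPt n k (j + 1) - ckPt n k j) * (x - ckPt n k j) : ℝ) : Circle)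

/-- The word length of `g` with respect to a set `S` of generators: the least `k` such
that `g` is a product of `k` elements of `S ∪ S⁻¹`. -/
def wordLength {G : Type*} [Group G] (S : Set G) (g : G) : ℕ :=
  sInf { k : ℕ | ∃ w : List G, w.length = k ∧ (∀ x ∈ w, x ∈ S ∨ x⁻¹ ∈ S) ∧ w.prod = g }


/-! ### Standard intervals and lists of standard intervals -/

abbrev Iv : Type := ℤ × ℕ

def pt (n : ℕ) (I : Iv) (y : ℝ) : ℝ := ((I.1 : ℝ) + y) / (n : ℝ) ^ I.2

def ch (n : ℕ) (I : Iv) : List Iv :=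
  (List.range n).map fun u : ℕ => ((n : ℤ) * I.1 + (u : ℤ), I.2 + 1)

def ex (n : ℕ) : ℕ → List Iv → List Iv
  | _, [] => []
  | 0, I :: L => ch n I ++ L
  | j + 1, I :: L => I :: ex n j L

def Aff (n : ℕ) (f : Circle → Circle) (I J : Iv) : Prop :=
  ∀ y ∈ Set.Icc (0 : ℝ) 1, f ((pt n I y : ℝ) : Circle) = ((pt n J y : ℝ) : Circle)

def Maps (n : ℕ) (f : Circle → Circle) (L M : List Iv) : Prop :=
  List.Forall₂ (Aff n f) L M

def PP (n : ℕ) : ℕ → List Iv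
  | 0 => [(0, 0)]
  | K + 1 => ex n (K * (n - 1)) (PP n K)

def Chain (n : ℕ) : ℝ → List Iv → ℝ → Prop
  | a, [], b => a = b
  | a, I :: L, b => pt n I 0 = a ∧ Chain n (pt n I 1) L b

theorem ch_length (n : ℕ) (I : Iv) : (ch n I).length = n := by simp [ch]

theorem ex_length {n : ℕ} (hn : 2 ≤ n) (j : ℕ) (L : List Iv) (h : j < L.length) :
    (ex n j L).length = L.length + (n - 1) := by
  induction L generalizing j with
  | nil => simp at h
  | cons I L ih =>
    cases j with
    | zero => simp [ex, ch_length]; omega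
    | succ j =>
      simp only [ex, List.length_cons] at h ⊢
      rw [ih j (by omega)]; omega

theorem PP_length {n : ℕ} (hn : 2 ≤ n) (K : ℕ) : (PP n K).length = K * (n - 1) + 1 := by
  induction K with
  | zero => simp [PP]
  | succ K ih =>
    rw [PP, ex_length hn _ _ (by omega), ih]; ring

theorem ex_append_left (n j : ℕ) (A B : List Iv) (h : j < A.length) :
    ex n j (A ++ B) = ex n j A ++ B := by
  induction A generalizing j with
  | nil => simp at h
  | cons I L ih =>
    cases j with
    | zero => simp [ex]
    | succ j =>
      simp only [ex, List.cons_append]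
      rw [ih j (by simpa using h)]

theorem ex_append_right (n j : ℕ) (A B : List Iv) :
    ex n (A.length + j) (A ++ B) = A ++ ex n j B := by
  induction A with
  | nil => simp
  | cons I L ih =>
    have : (I :: L).length + j = (L.length + j) + 1 := by simp; omega
    rw [this]
    simp only [ex, List.cons_append]
    rw [ih]

theorem ex_comm {n : ℕ} (hn : 2 ≤ n) (i j : ℕ) (L : List Iv) (hij : i < j) :
    ex n (j + (n - 1)) (ex n i L) = ex n i (ex n j L) := by
  induction L generalizing i j with
  | nil => simp [ex]
  | cons I L ih =>
    obtain ⟨j, rfl⟩ : ∃ j', j = j' + 1 := ⟨j - 1, by omega⟩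
    cases i with
    | zero =>
      simp only [ex]
      have : j + 1 + (n - 1) = (ch n I).length + j := by rw [ch_length]; omega
      rw [this, ex_append_right]
    | succ i =>
      have : j + 1 + (n - 1) = (j + (n - 1)) + 1 := by omega
      rw [this]
      simp only [ex]
      rw [ih i j (by omega)]

theorem ex_rotate1 {n : ℕ} (j l : ℕ) (L : List Iv) (h : j + l < L.length) :
    ex n j (L.rotate l) = (ex n (j + l) L).rotate l := by
  obtain ⟨A, B, rfl, hA⟩ : ∃ A B, L = A ++ B ∧ A.length = l :=
    ⟨L.take l, L.drop l, (List.take_append_drop l L).symm, by simp; omega⟩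
  subst hA
  rw [List.rotate_append_length_eq, ex_append_left _ _ _ _ (by simp at h; omega), add_comm,
    ex_append_right, List.rotate_append_length_eq]

theorem ex_rotate2 {n : ℕ} (hn : 2 ≤ n) (j l : ℕ) (L : List Iv) (h : L.length ≤ j + l)
    (hj : j < L.length) (hl : l ≤ L.length) :
    ex n j (L.rotate l) = (ex n (j + l - L.length) L).rotate (l + (n - 1)) := by
  obtain ⟨A, B, rfl, hA⟩ : ∃ A B, L = A ++ B ∧ A.length = l :=
    ⟨L.take l, L.drop l, (List.take_append_drop l L).symm, by simp; omega⟩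
  subst hA
  simp only [List.length_append] at h hj hl ⊢
  have h1 : j + A.length - (A.length + B.length) < A.length := by omega
  have h2 : j = B.length + (j + A.length - (A.length + B.length)) := by omega
  rw [List.rotate_append_length_eq, ex_append_left _ _ _ _ h1, ← ex_length hn _ _ h1,
    List.rotate_append_length_eq]
  conv_lhs => rw [h2]
  rw [ex_append_right]

/-! ### The relation `Maps` -/

theorem pt_child {n : ℕ} (hn : 2 ≤ n) (I : Iv) (u : ℕ) (z : ℝ) :
    pt n ((n : ℤ) * I.1 + (u : ℤ), I.2 + 1) z = pt n I ((u + z) / n) := by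
  have : (n : ℝ) ≠ 0 := by positivity
  simp only [pt]
  push_cast
  field_simp
  ring

theorem aff_ch {n : ℕ} (hn : 2 ≤ n) {f : Circle → Circle} {I J : Iv} :
    List.Forall₂ (Aff n f) (ch n I) (ch n J) ↔ Aff n f I J := by
  have hn0 : (0 : ℝ) < n := by positivity
  rw [ch, ch, List.forall₂_map_left_iff, List.forall₂_map_right_iff, List.forall₂_same]
  constructor
  · intro h y hy
    obtain ⟨u, hu, z, hz, rfl⟩ : ∃ u < n, ∃ z ∈ Set.Icc (0 : ℝ) 1, y = (u + z) / n := by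
      by_cases h1 : y = 1
      · refine ⟨n - 1, by omega, 1, by simp, ?_⟩
        rw [h1, Nat.cast_sub (by omega)]
        field_simp
        simp
      · have hy1 : y < 1 := lt_of_le_of_ne hy.2 h1
        have h0 : 0 ≤ (n : ℝ) * y := mul_nonneg hn0.le hy.1
        refine ⟨⌊(n : ℝ) * y⌋₊, ?_, n * y - ⌊(n : ℝ) * y⌋₊, ⟨?_, ?_⟩, ?_⟩
        · rw [Nat.floor_lt h0]; nlinarith
        · have := Nat.floor_le h0; linarith
        · have := Nat.lt_floor_add_one ((n : ℝ) * y); linarith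
        · field_simp; ring
    have := h u (by simpa using hu) z hz
    rwa [pt_child hn, pt_child hn] at this
  · intro h u hu z hz
    rw [pt_child hn, pt_child hn]
    have hu' : (u : ℝ) + 1 ≤ n := by
      have : u + 1 ≤ n := by simpa using hu
      exact_mod_cast this
    apply h
    constructor
    · have := hz.1; positivity
    · rw [div_le_one hn0]; linarith [hz.2]

theorem forall2_append_inv {α β : Type*} {R : α → β → Prop} {A C : List α} {B D : List β}
    (h : List.Forall₂ R (A ++ C) (B ++ D)) (hl : A.length = B.length) :
    List.Forall₂ R A B ∧ List.Forall₂ R C D := by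
  have h1 := List.forall₂_take A.length h
  have h2 := List.forall₂_drop A.length h
  rw [List.take_left, hl, List.take_left] at h1
  rw [List.drop_left, hl, List.drop_left] at h2
  exact ⟨h1, h2⟩

theorem Maps.append {n : ℕ} {f : Circle → Circle} {A B C D : List Iv}
    (h1 : Maps n f A B) (h2 : Maps n f C D) : Maps n f (A ++ C) (B ++ D) :=
  List.rel_append h1 h2

theorem Maps.ex {n : ℕ} (hn : 2 ≤ n) {f : Circle → Circle} {L M : List Iv}
    (h : Maps n f L M) (j : ℕ) : Maps n f (ex n j L) (ex n j M) := by
  induction h generalizing j with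
  | nil => simp [ThompsonPaper.ex, Maps]
  | cons h1 h2 ih =>
    cases j with
    | zero => exact Maps.append ((aff_ch hn).2 h1) h2
    | succ j => exact List.Forall₂.cons h1 (ih j)

theorem Maps.of_ex {n : ℕ} (hn : 2 ≤ n) {f : Circle → Circle} {L M : List Iv} (j : ℕ)
    (h : Maps n f (ThompsonPaper.ex n j L) (ThompsonPaper.ex n j M))
    (hl : L.length = M.length) : Maps n f L M := by
  induction L generalizing j M with
  | nil =>
    obtain rfl : M = [] := by simpa using hl.symm
    exact List.Forall₂.nil
  | cons I L ih =>
    obtain ⟨J, M, rfl⟩ : ∃ J M', M = J :: M' := by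
      cases M with
      | nil => simp at hl
      | cons J M => exact ⟨J, M, rfl⟩
    cases j with
    | zero =>
      have := forall2_append_inv h (by simp [ch_length])
      exact List.Forall₂.cons ((aff_ch hn).1 this.1) this.2
    | succ j =>
      simp only [ThompsonPaper.ex, Maps, List.forall₂_cons] at h
      exact List.Forall₂.cons h.1 (ih j h.2 (by simpa using hl))

theorem Maps.rotate {n : ℕ} {f : Circle → Circle} {L M : List Iv}
    (h : Maps n f L M) (l : ℕ) : Maps n f (L.rotate l) (M.rotate l) := by
  have hl := List.Forall₂.length_eq h
  rw [← List.rotate_mod L, ← List.rotate_mod M, ← hl]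
  rcases Nat.eq_zero_or_pos L.length with h0 | h0
  · have h1 : L = [] := by simpa using h0
    have h2 : M = [] := by rw [hl] at h0; simpa using h0
    subst h1 h2; simpa using h
  · have hlt := (Nat.mod_lt l h0).le
    rw [List.rotate_eq_drop_append_take hlt, List.rotate_eq_drop_append_take (hl ▸ hlt)]
    exact Maps.append (List.forall₂_drop _ h) (List.forall₂_take _ h)

theorem Maps.comp {n : ℕ} {f g : Circle → Circle} {L M N : List Iv}
    (hg : Maps n g M N) (hf : Maps n f L M) : Maps n (g ∘ f) L N := by
  induction hf generalizing N with
  | nil => cases hg; exact List.Forall₂.nil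
  | cons h1 h2 ih =>
    cases hg with
    | cons h3 h4 =>
      refine List.Forall₂.cons ?_ (ih h4)
      intro y hy
      rw [Function.comp, h1 y hy, h3 y hy]

theorem Maps.id (n : ℕ) (L : List Iv) : Maps n id L L :=
  List.forall₂_same.2 fun _ _ _ _ => rfl

theorem Maps.mul {n : ℕ} {f g : Circle ≃ₜ Circle} {L M N : List Iv}
    (hg : Maps n g M N) (hf : Maps n f L M) : Maps n (g * f : Circle ≃ₜ Circle) L N :=
  show Maps n (g ∘ f) L N from Maps.comp hg hf

theorem Maps.inv {n : ℕ} {f : Circle ≃ₜ Circle} {L M : List Iv}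
    (hf : Maps n f L M) : Maps n (f⁻¹ : Circle ≃ₜ Circle) M L := by
  refine List.Forall₂.flip (List.Forall₂.imp ?_ hf)
  intro I J h y hy
  rw [← h y hy]
  exact f.symm_apply_apply _

/-! ### Chains -/

theorem pt_lt {n : ℕ} (hn : 2 ≤ n) (I : Iv) {x y : ℝ} (h : x < y) : pt n I x < pt n I y := by
  have : (0 : ℝ) < n := by positivity
  simp only [pt]
  gcongr

theorem pt_exists {n : ℕ} (hn : 2 ≤ n) (I : Iv) {x : ℝ} (h0 : pt n I 0 ≤ x)
    (h1 : x ≤ pt n I 1) : ∃ y ∈ Set.Icc (0 : ℝ) 1, x = pt n I y := by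
  have hp : (0 : ℝ) < (n : ℝ) ^ I.2 := by positivity
  simp only [pt] at *
  rw [div_le_iff₀ hp] at h0
  rw [le_div_iff₀ hp] at h1
  refine ⟨x * n ^ I.2 - I.1, ⟨by linarith, by linarith⟩, ?_⟩
  field_simp
  ring

theorem Chain.append {n : ℕ} {a b c : ℝ} {A B : List Iv} (h1 : Chain n a A b)
    (h2 : Chain n b B c) : Chain n a (A ++ B) c := by
  induction A generalizing a with
  | nil => simp only [Chain] at h1; subst h1; exact h2
  | cons I L ih => exact ⟨h1.1, ih h1.2⟩

theorem Chain.append_inv {n : ℕ} {a c : ℝ} {A B : List Iv} (h : Chain n a (A ++ B) c) :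
    ∃ b, Chain n a A b ∧ Chain n b B c := by
  induction A generalizing a with
  | nil => exact ⟨a, rfl, h⟩
  | cons I L ih =>
    obtain ⟨b, h1, h2⟩ := ih h.2
    exact ⟨b, ⟨h.1, h1⟩, h2⟩

theorem Chain.le {n : ℕ} (hn : 2 ≤ n) {a b : ℝ} {L : List Iv} (h : Chain n a L b) : a ≤ b := by
  induction L generalizing a with
  | nil => exact le_of_eq h
  | cons I L ih =>
    have := pt_lt hn I (zero_lt_one)
    have := ih h.2
    have := h.1
    linarith

theorem Chain.mem {n : ℕ} (hn : 2 ≤ n) {a b : ℝ} {L : List Iv} (h : Chain n a L b)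
    {I : Iv} (hI : I ∈ L) : a ≤ pt n I 0 ∧ pt n I 1 ≤ b := by
  induction L generalizing a with
  | nil => simp at hI
  | cons J L ih =>
    have h1 := pt_lt hn J (zero_lt_one)
    have h2 := h.1
    have h3 := h.2.le hn
    rcases List.mem_cons.1 hI with rfl | hI
    · exact ⟨h2.ge, h3⟩
    · have := ih h.2 hI
      exact ⟨by linarith, this.2⟩

theorem Chain.cover {n : ℕ} (hn : 2 ≤ n) {a b : ℝ} {L : List Iv} (h : Chain n a L b)
    {x : ℝ} (h0 : a ≤ x) (h1 : x < b) :
    ∃ i, ∃ hi : i < L.length, ∃ y ∈ Set.Icc (0 : ℝ) 1, x = pt n L[i] y := by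
  induction L generalizing a with
  | nil => simp only [Chain] at h; linarith
  | cons J L ih =>
    by_cases hx : x ≤ pt n J 1
    · exact ⟨0, by simp, pt_exists hn J (h.1.trans_le h0) hx⟩
    · obtain ⟨i, hi, y, hy, e⟩ := ih h.2 (le_of_not_ge hx)
      exact ⟨i + 1, by simpa using hi, y, hy, by simpa using e⟩

theorem Maps.ext {n : ℕ} (hn : 2 ≤ n) {f g : Circle ≃ₜ Circle} {L M : List Iv}
    (hL : Chain n 0 L 1) (hf : Maps n f L M) (hg : Maps n g L M) : f = g := by
  apply Homeomorph.ext
  intro x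
  obtain ⟨x, ⟨h0, h1⟩, rfl⟩ := AddCircle.eq_coe_Ico x
  obtain ⟨i, hi, y, hy, rfl⟩ := hL.cover hn h0 h1
  have hl := List.Forall₂.length_eq hf
  have e1 := List.Forall₂.get hf hi (hl ▸ hi) y hy
  have e2 := List.Forall₂.get hg hi (hl ▸ hi) y hy
  simp only [List.get_eq_getElem] at e1 e2
  rw [e1, e2]

theorem chain_range {n : ℕ} (hn : 2 ≤ n) (I : Iv) (m : ℕ) :
    Chain n (pt n I 0)
      ((List.range m).map fun u : ℕ => ((n : ℤ) * I.1 + (u : ℤ), I.2 + 1)) (pt n I (m / n)) := by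
  induction m with
  | zero => simp [Chain]
  | succ m ih =>
    rw [List.range_succ, List.map_append]
    refine ih.append ?_
    simp only [List.map_cons, List.map_nil, Chain, pt_child hn]
    constructor
    · simp
    · push_cast; rfl

theorem chain_ch {n : ℕ} (hn : 2 ≤ n) (I : Iv) :
    Chain n (pt n I 0) (ch n I) (pt n I 1) := by
  have := chain_range hn I n
  rwa [div_self (by positivity)] at this

theorem Chain.ex {n : ℕ} (hn : 2 ≤ n) {a b : ℝ} {L : List Iv} (h : Chain n a L b) (j : ℕ) :
    Chain n a (ex n j L) b := by
  induction L generalizing a j with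
  | nil => simpa [ThompsonPaper.ex] using h
  | cons I L ih =>
    cases j with
    | zero =>
      obtain ⟨h1, h2⟩ := h
      subst h1
      exact (chain_ch hn I).append h2
    | succ j => exact ⟨h.1, ih h.2 j⟩

theorem chain_PP {n : ℕ} (hn : 2 ≤ n) (K : ℕ) : Chain n 0 (PP n K) 1 := by
  induction K with
  | zero => simp [PP, Chain, pt]
  | succ K ih => exact ih.ex hn _

/-! ### Existence of elements of `T_n` -/

theorem pl_exists {n : ℕ} (hn : 2 ≤ n) (L M : List Iv) (hl : L.length = M.length)
    (a b a' b' : ℝ) (hL : Chain n a L b) (hM : Chain n a' M b') :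
    ∃ F : ℝ → ℝ, StrictMono F ∧ Continuous F ∧ F a = a' ∧ F b = b' ∧
      ∀ i (h : i < L.length) (h' : i < M.length), ∀ y ∈ Set.Icc (0 : ℝ) 1,
        F (pt n L[i] y) = pt n M[i] y := by
  have hn0 : (0 : ℝ) < n := by positivity
  induction L generalizing M a a' with
  | nil =>
    obtain rfl : M = [] := by simpa using hl.symm
    simp only [Chain] at hL hM
    subst hL hM
    refine ⟨fun x => x + (a' - a), fun x y h => by simpa using h, by fun_prop, by simp, by simp, ?_⟩
    intro i h
    simp at h
  | cons I L ih =>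
    obtain ⟨J, M, rfl⟩ : ∃ J M', M = J :: M' := by
      cases M with
      | nil => simp at hl
      | cons J M => exact ⟨J, M, rfl⟩
    obtain ⟨G, G1, G2, G3, G4, G5⟩ := ih M (by simpa using hl) _ _ hL.2 hM.2
    set c := pt n I 1 with hc
    set c' := pt n J 1 with hc'
    set s : ℝ := (n : ℝ) ^ I.2 / (n : ℝ) ^ J.2 with hs
    have hs0 : 0 < s := by positivity
    let F : ℝ → ℝ := fun x => if x ≤ c then c' + s * (x - c) else G x
    have F1 : ∀ x, x ≤ c → F x = c' + s * (x - c) := fun x hx => if_pos hx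
    have F2 : ∀ x, c ≤ x → F x = G x := by
      intro x hx
      rcases hx.eq_or_lt with h | h
      · rw [F1 x h.ge, ← h, G3]; ring
      · exact if_neg (not_le.2 h)
    have F3 : ∀ y ≤ (1 : ℝ), F (pt n I y) = pt n J y := by
      intro y hy
      have : pt n I y ≤ c := by
        rcases hy.eq_or_lt with h | h
        · rw [h]
        · exact (pt_lt hn I h).le
      rw [F1 _ this, hc, hc', hs]
      simp only [pt]
      field_simp
      ring
    refine ⟨F, ?_, ?_, ?_, ?_, ?_⟩
    · refine StrictMonoOn.Iic_union_Ici (a := c) ?_ ?_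
      · intro x hx y hy hxy
        rw [F1 x hx, F1 y hy]
        gcongr
      · intro x hx y hy hxy
        rw [F2 x hx, F2 y hy]
        exact G1 hxy
    · refine Continuous.if_le (by fun_prop) G2 continuous_id continuous_const ?_
      intro x hx
      rw [hx, G3]; ring
    · rw [← hL.1, F3 0 zero_le_one, hM.1]
    · rw [F2 b (hL.2.le hn), G4]
    · intro i h h' y hy
      cases i with
      | zero => exact F3 y hy.2
      | succ i =>
        simp only [List.getElem_cons_succ]
        rw [F2, G5 i _ _ y hy]
        have h2 : L[i]'(by simpa using h) ∈ L := List.getElem_mem _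
        refine (hL.2.mem hn h2).1.trans ?_
        rcases hy.1.eq_or_lt with h | h
        · rw [← h]
        · exact (pt_lt hn _ h).le

theorem IsNAdic.add {n : ℕ} (hn : 2 ≤ n) {x y : ℝ} (hx : IsNAdic n x) (hy : IsNAdic n y) :
    IsNAdic n (x + y) := by
  obtain ⟨a, k, rfl⟩ := hx
  obtain ⟨b, l, rfl⟩ := hy
  have : (0 : ℝ) < n := by positivity
  refine ⟨a * n ^ l + b * n ^ k, k + l, ?_⟩
  push_cast
  rw [pow_add]
  field_simp

theorem isNAdic_int (n : ℕ) (a : ℤ) : IsNAdic n a := ⟨a, 0, by simp⟩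

theorem IsNAdic.div {n : ℕ} (hn : 2 ≤ n) {x : ℝ} (hx : IsNAdic n x) (k : ℕ) :
    IsNAdic n (x / (n : ℝ) ^ k) := by
  obtain ⟨a, l, rfl⟩ := hx
  have : (0 : ℝ) < n := by positivity
  exact ⟨a, l + k, by rw [pow_add]; field_simp⟩

theorem IsNAdic.mul {n : ℕ} {x : ℝ} (hx : IsNAdic n x) (k : ℕ) :
    IsNAdic n (x * (n : ℝ) ^ k) := by
  obtain ⟨a, l, rfl⟩ := hx
  exact ⟨a * n ^ k, l, by push_cast; ring⟩

theorem IsNAdic.neg {n : ℕ} {x : ℝ} (hx : IsNAdic n x) :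
    IsNAdic n (-x) := by
  obtain ⟨a, l, rfl⟩ := hx
  exact ⟨-a, l, by push_cast; ring⟩

theorem isNAdic_pt {n : ℕ} (hn : 2 ≤ n) (I : Iv) {y : ℝ} (hy : IsNAdic n y) :
    IsNAdic n (pt n I y) := ((isNAdic_int n I.1).add hn hy).div hn _

theorem isNAdic_of_pt {n : ℕ} (hn : 2 ≤ n) (I : Iv) {y : ℝ} (hy : IsNAdic n (pt n I y)) :
    IsNAdic n y := by
  have : (0 : ℝ) < n := by positivity
  have h := (hy.mul I.2).add hn (isNAdic_int n I.1).neg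
  have e : pt n I y * (n : ℝ) ^ I.2 + -(I.1 : ℝ) = y := by
    simp only [pt]; field_simp; ring
  rwa [e] at h

theorem coe_eq_iff (x y : ℝ) : (x : Circle) = (y : Circle) ↔ ∃ z : ℤ, y = x + z := by
  rw [QuotientAddGroup.eq, AddSubgroup.mem_zmultiples_iff]
  constructor
  · rintro ⟨k, hk⟩
    refine ⟨k, ?_⟩
    simp at hk
    linarith
  · rintro ⟨k, hk⟩
    exact ⟨k, by simp [hk]⟩

theorem coe_mem_nAdic {n : ℕ} (hn : 2 ≤ n) (x : ℝ) :
    (x : Circle) ∈ nAdicPoints n ↔ IsNAdic n x := by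
  constructor
  · rintro ⟨y, hy, h⟩
    obtain ⟨z, hz⟩ := (coe_eq_iff y x).1 h.symm
    rw [hz]
    exact hy.add hn (isNAdic_int n z)
  · intro h; exact ⟨x, h, rfl⟩

theorem Maps.image_nAdic {n : ℕ} (hn : 2 ≤ n) {f : Circle ≃ₜ Circle} {L M : List Iv}
    (hL : Chain n 0 L 1) (hf : Maps n f L M) : f '' nAdicPoints n = nAdicPoints n := by
  have key : ∀ x : Circle, x ∈ nAdicPoints n ↔ f x ∈ nAdicPoints n := by
    intro x
    obtain ⟨x, ⟨h0, h1⟩, rfl⟩ := AddCircle.eq_coe_Ico x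
    obtain ⟨i, hi, y, hy, rfl⟩ := hL.cover hn h0 h1
    have hl := List.Forall₂.length_eq hf
    have e1 := List.Forall₂.get hf hi (hl ▸ hi) y hy
    simp only [List.get_eq_getElem] at e1
    rw [e1, coe_mem_nAdic hn, coe_mem_nAdic hn]
    exact ⟨fun h => isNAdic_pt hn _ (isNAdic_of_pt hn _ h),
      fun h => isNAdic_pt hn _ (isNAdic_of_pt hn _ h)⟩
  ext y
  constructor
  · rintro ⟨x, hx, rfl⟩
    exact (key x).1 hx
  · intro hy
    refine ⟨f.symm y, (key _).2 ?_, f.apply_symm_apply y⟩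
    rwa [f.apply_symm_apply]

theorem exists_homeo (F : ℝ → ℝ) (a : ℝ) (h1 : StrictMono F) (h2 : Continuous F)
    (h3 : F 0 = a) (h4 : F 1 = a + 1) :
    ∃ f : Circle ≃ₜ Circle, ∀ x ∈ Set.Icc (0 : ℝ) 1, f (x : Circle) = ((F x : ℝ) : Circle) := by
  let G : ℝ → Circle := fun x => ((F x : ℝ) : Circle)
  have hG : G 0 = G (0 + 1) := by
    simp only [G, zero_add, h3, h4]
    exact (coe_eq_iff _ _).2 ⟨1, by simp⟩
  have hGc : Continuous G := (AddCircle.continuous_mk' (1 : ℝ)).comp h2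
  let φ : Circle → Circle := AddCircle.liftIco 1 0 G
  have hφc : Continuous φ := AddCircle.liftIco_continuous hG hGc.continuousOn
  have hφ0 : ∀ x ∈ Set.Ico (0 : ℝ) 1, φ (x : Circle) = G x := by
    intro x hx
    exact AddCircle.liftIco_coe_apply (by simpa using hx)
  have hφ : ∀ x ∈ Set.Icc (0 : ℝ) 1, φ (x : Circle) = G x := by
    intro x hx
    rcases hx.2.eq_or_lt with h | h
    · have e : ((1 : ℝ) : Circle) = ((0 : ℝ) : Circle) := (coe_eq_iff _ _).2 ⟨-1, by simp⟩
      rw [h, e, hφ0 0 (by simp), hG, zero_add]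
    · exact hφ0 x ⟨hx.1, h⟩
  have hm : ∀ x ∈ Set.Ico (0 : ℝ) 1, F x ∈ Set.Ico a (a + 1) := by
    intro x hx
    have e1 := h1.monotone hx.1
    have e2 := h1 hx.2
    rw [h3] at e1
    rw [h4] at e2
    exact ⟨e1, e2⟩
  have hinj : Function.Injective φ := by
    intro x y hxy
    obtain ⟨x, hx, rfl⟩ := AddCircle.eq_coe_Ico x
    obtain ⟨y, hy, rfl⟩ := AddCircle.eq_coe_Ico y
    rw [hφ0 x hx, hφ0 y hy] at hxy
    rw [h1.injective ((AddCircle.coe_eq_coe_iff_of_mem_Ico (hm x hx) (hm y hy)).1 hxy)]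
  have hsurj : Function.Surjective φ := by
    intro y
    obtain ⟨y, rfl⟩ := QuotientAddGroup.mk_surjective y
    have hz := Int.fract_nonneg (y - a)
    have hz1 := (Int.fract_lt_one (y - a)).le
    have : a + Int.fract (y - a) ∈ Set.Icc (F 0) (F 1) := by
      rw [h3, h4]; constructor <;> linarith
    obtain ⟨x, hx, e⟩ := intermediate_value_Icc zero_le_one h2.continuousOn this
    refine ⟨(x : Circle), ?_⟩
    rw [hφ x hx]
    simp only [G, e]
    refine (coe_eq_iff _ _).2 ⟨⌊y - a⌋, ?_⟩
    have := Int.fract_add_floor (y - a)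
    linarith
  refine ⟨Continuous.homeoOfEquivCompactToT2 (f := Equiv.ofBijective φ ⟨hinj, hsurj⟩) hφc, ?_⟩
  intro x hx
  exact hφ x hx

theorem exists_T {n : ℕ} (hn : 2 ≤ n) (L M : List Iv) (hl : L.length = M.length)
    (a : ℝ) (hL : Chain n 0 L 1) (hM : Chain n a M (a + 1)) :
    ∃ f ∈ TnSet n, Maps n f L M := by
  have hn0 : (0 : ℝ) < n := by positivity
  obtain ⟨F, F1, F2, F3, F4, F5⟩ := pl_exists hn L M hl _ _ _ _ hL hM
  obtain ⟨f, hf⟩ := exists_homeo F a F1 F2 F3 F4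
  have hrange : ∀ I ∈ L, ∀ y ∈ Set.Icc (0 : ℝ) 1, pt n I y ∈ Set.Icc (0 : ℝ) 1 := by
    intro I hI y hy
    have h1 := hL.mem hn hI
    have hm : Monotone (pt n I) := (show StrictMono (pt n I) from fun _ _ h => pt_lt hn I h).monotone
    exact ⟨h1.1.trans (hm hy.1), (hm hy.2).trans h1.2⟩
  have hmaps : Maps n f L M := by
    refine List.forall₂_iff_get.2 ⟨hl, ?_⟩
    intro i h h' y hy
    simp only [List.get_eq_getElem]
    rw [hf _ (hrange _ (List.getElem_mem _) y hy), F5 i h h' y hy]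
  refine ⟨f, ⟨hmaps.image_nAdic hn hL, fun x => ⌊x⌋ + F (Int.fract x), ?_, ?_, ?_, ?_⟩, hmaps⟩
  · intro x y hxy
    show (⌊x⌋ : ℝ) + F (Int.fract x) < ⌊y⌋ + F (Int.fract y)
    rcases (Int.floor_le_floor hxy.le).eq_or_lt with h | h
    · rw [h]
      have : Int.fract x < Int.fract y := by
        simp only [Int.fract, h]; linarith
      linarith [F1 this]
    · have h1 : (⌊x⌋ : ℝ) + 1 ≤ ⌊y⌋ := by exact_mod_cast h
      have h2 := F1 (Int.fract_lt_one x)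
      have h3 := F1.monotone (Int.fract_nonneg y)
      linarith
  · intro x
    have e : (x : Circle) = ((Int.fract x : ℝ) : Circle) :=
      (coe_eq_iff _ _).2 ⟨-⌊x⌋, by rw [Int.fract]; push_cast; ring⟩
    rw [e, hf _ ⟨Int.fract_nonneg x, (Int.fract_lt_one x).le⟩]
    exact (coe_eq_iff _ _).2 ⟨⌊x⌋, by ring⟩
  · intro x
    simp
    ring
  · have hpos : 0 < L.length := by
      rcases L with _ | ⟨I, L⟩
      · simp [Chain] at hL
      · simp
    let t : ℕ → ℝ := fun i => if h : i < L.length then pt n L[i] 0 else 1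
    have t1 : ∀ i (h : i < L.length), t i = pt n L[i] 0 := fun i h => dif_pos h
    have t2 : ∀ i (h : i < L.length), t (i + 1) = pt n L[i] 1 := by
      intro i h
      have hs : Chain n 0 (L.take i ++ L[i] :: L.drop (i + 1)) 1 := by
        rw [List.getElem_cons_drop, List.take_append_drop]; exact hL
      obtain ⟨b, -, -, hb⟩ := hs.append_inv
      by_cases h2 : i + 1 < L.length
      · rw [t1 _ h2]
        rw [List.drop_eq_getElem_cons h2] at hb
        exact hb.1
      · rw [List.drop_eq_nil_of_le (by omega)] at hb
        rw [hb]
        exact dif_neg h2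
    let J : ℕ → Iv := fun i => L.getD i (0, 0)
    let J' : ℕ → Iv := fun i => M.getD i (0, 0)
    have hJ : ∀ i (h : i < L.length), J i = L[i] := fun i h => by simp [J, h]
    have hJ' : ∀ i (h : i < M.length), J' i = M[i] := fun i h => by simp [J', h]
    refine ⟨L.length, t, fun i => ((J i).2 : ℤ) - ((J' i).2 : ℤ),
      fun i => pt n (J' i) 0 - (n : ℝ) ^ (((J i).2 : ℤ) - ((J' i).2 : ℤ)) * pt n (J i) 0,
      hpos, ?_, ?_, ?_, ?_, ?_⟩
    · rw [t1 0 hpos]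
      rcases L with _ | ⟨I, L⟩
      · simp at hpos
      · exact hL.1
    · exact dif_neg (lt_irrefl _)
    · intro i hi
      rw [t1 i hi, t2 i hi]
      exact pt_lt hn _ zero_lt_one
    · intro i hi
      rcases hi.eq_or_lt with h | h
      · have : t i = ((1 : ℤ) : ℝ) := by rw [h]; simp [t]
        rw [this]; exact isNAdic_int n 1
      · rw [t1 i h]
        exact isNAdic_pt hn _ (by simpa using isNAdic_int n 0)
    · intro i hi x hx
      rw [t1 i hi, t2 i hi] at hx
      obtain ⟨y, hy, rfl⟩ := pt_exists hn _ hx.1 hx.2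
      have hi' : i < M.length := hl ▸ hi
      have hfl : (⌊pt n L[i] y⌋ : ℝ) + F (Int.fract (pt n L[i] y)) = F (pt n L[i] y) := by
        have hr := hrange _ (List.getElem_mem hi) y hy
        rcases hr.2.eq_or_lt with h | h
        · rw [h]; simp [F3, F4, add_comm]
        · have h0 : ⌊pt n L[i] y⌋ = 0 := Int.floor_eq_zero_iff.2 ⟨hr.1, h⟩
          have h5 : Int.fract (pt n L[i] y) = pt n L[i] y := Int.fract_eq_self.2 ⟨hr.1, h⟩
          rw [h0, h5]; simp
      simp only [hfl, F5 i hi hi' y hy, hJ i hi, hJ' i hi']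
      rw [zpow_sub₀ hn0.ne', zpow_natCast, zpow_natCast]
      simp only [pt]
      field_simp
      ring

/-! ### The elements `X j` and the rotations -/

def MT (n : ℕ) (f : Tn n) (L M : List Iv) : Prop := Maps n (f : Circle ≃ₜ Circle) L M

theorem MT.mul {n : ℕ} {f g : Tn n} {L M N : List Iv}
    (hg : MT n g M N) (hf : MT n f L M) : MT n (g * f) L N := by
  have := Maps.mul hg hf
  exact this

theorem MT.inv {n : ℕ} {f : Tn n} {L M : List Iv}
    (hf : MT n f L M) : MT n f⁻¹ M L := by
  have := Maps.inv hf
  exact this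

theorem MT.one (n : ℕ) (L : List Iv) : MT n 1 L L := Maps.id n L

theorem MT.ext {n : ℕ} (hn : 2 ≤ n) {f g : Tn n} {L M : List Iv}
    (hL : Chain n 0 L 1) (hf : MT n f L M) (hg : MT n g L M) : f = g :=
  Subtype.ext (Maps.ext hn hL hf hg)

theorem MT.ex {n : ℕ} (hn : 2 ≤ n) {f : Tn n} {L M : List Iv}
    (hf : MT n f L M) (j : ℕ) : MT n f (ex n j L) (ex n j M) := Maps.ex hn hf j

theorem MT.rotate {n : ℕ} {f : Tn n} {L M : List Iv}
    (hf : MT n f L M) (l : ℕ) : MT n f (L.rotate l) (M.rotate l) := Maps.rotate hf l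

theorem MT.pow_rotate {n : ℕ} {f : Tn n} {L : List Iv}
    (hf : MT n f L (L.rotate 1)) (l : ℕ) : MT n (f ^ l) L (L.rotate l) := by
  induction l with
  | zero => simpa using MT.one n L
  | succ l ih =>
    have := (hf.rotate l).mul ih
    rwa [List.rotate_rotate, ← pow_succ', add_comm 1 l] at this

def IsX (n : ℕ) (X : ℕ → Tn n) : Prop :=
  ∀ j K, j < K * (n - 1) → MT n (X j) (PP n (K + 1)) (ex n j (PP n K))

theorem exists_X {n : ℕ} (hn : 2 ≤ n) : ∃ X : ℕ → Tn n, IsX n X := by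
  have h : ∀ j : ℕ, ∃ f : Tn n, ∀ K, j < K * (n - 1) →
      MT n f (PP n (K + 1)) (ex n j (PP n K)) := by
    intro j
    obtain ⟨f, hf, hm⟩ := exists_T hn (PP n (j / (n - 1) + 1 + 1))
      (ex n j (PP n (j / (n - 1) + 1)))
      (by
        have h1 : j < (j / (n - 1) + 1) * (n - 1) := by
          rw [mul_comm]; exact Nat.lt_mul_div_succ j (by omega)
        rw [ex_length hn _ _ (by rw [PP_length hn]; omega), PP_length hn, PP_length hn]; ring)
      0 (chain_PP hn _) (by simpa using (chain_PP hn _).ex hn j)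
    refine ⟨⟨f, Subgroup.subset_closure hf⟩, ?_⟩
    have step : ∀ d, MT n ⟨f, Subgroup.subset_closure hf⟩ (PP n (j / (n - 1) + 1 + d + 1))
        (ex n j (PP n (j / (n - 1) + 1 + d))) := by
      intro d
      induction d with
      | zero => exact hm
      | succ d ih =>
        have h1 : j < (j / (n - 1) + 1 + d) * (n - 1) := by
          have : j < (j / (n - 1) + 1) * (n - 1) := by
            rw [mul_comm]; exact Nat.lt_mul_div_succ j (by omega)
          nlinarith
        have h2 := ih.ex hn ((j / (n - 1) + 1 + d + 1) * (n - 1))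
        have h3 : (j / (n - 1) + 1 + d + 1) * (n - 1)
            = (j / (n - 1) + 1 + d) * (n - 1) + (n - 1) := by ring
        conv at h2 => arg 4; rw [h3]
        rw [ex_comm hn _ _ _ h1] at h2
        exact h2
    intro K hK
    have h4 : j / (n - 1) + 1 ≤ K := by
      have := (Nat.div_lt_iff_lt_mul (by omega : 0 < n - 1)).2 hK
      omega
    obtain ⟨d, rfl⟩ := Nat.exists_eq_add_of_le h4
    exact step d
  choose X hX using h
  exact ⟨X, hX⟩

theorem X_rel {n : ℕ} (hn : 2 ≤ n) {X : ℕ → Tn n} (hX : IsX n X) {i j : ℕ} (hij : i < j) :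
    X j * X i = X i * X (j + (n - 1)) := by
  have hK : j < (j + 1) * (n - 1) := by
    have : 1 ≤ n - 1 := by omega
    nlinarith
  have a1 := hX i (j + 1) (by omega)
  have a2 := hX j (j + 1) hK
  have a3 := hX i (j + 1 + 1) (by rw [add_mul _ 1]; omega)
  have a4 := hX (j + (n - 1)) (j + 1 + 1) (by rw [add_mul _ 1]; omega)
  have b1 := (a2.ex hn i).mul a3
  have b2 := (a1.ex hn (j + (n - 1))).mul a4
  rw [ex_comm hn _ _ _ hij] at b2
  exact b1.ext hn (chain_PP hn _) b2

theorem rot_step1 {n : ℕ} {h a b : Tn n} {K j l : ℕ} (hn : 2 ≤ n)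
    (hh : MT n h (PP n K) ((PP n K).rotate l)) (hjl : j + l ≤ K * (n - 1))
    (ha : MT n a (PP n (K + 1)) (ex n j (PP n K)))
    (hb : MT n b (PP n (K + 1)) (ex n (j + l) (PP n K))) :
    MT n (b⁻¹ * h * a) (PP n (K + 1)) ((PP n (K + 1)).rotate l) := by
  have h1 := (hh.ex hn j).mul ha
  rw [ex_rotate1 _ _ _ (by rw [PP_length hn]; omega)] at h1
  rw [mul_assoc]
  exact (hb.inv.rotate l).mul h1

theorem rot_step2 {n : ℕ} {h a b : Tn n} {K j l : ℕ} (hn : 2 ≤ n)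
    (hh : MT n h (PP n K) ((PP n K).rotate l)) (hjl : K * (n - 1) + 1 ≤ j + l)
    (hj : j ≤ K * (n - 1)) (hl : l ≤ K * (n - 1) + 1)
    (ha : MT n a (PP n (K + 1)) (ex n j (PP n K)))
    (hb : MT n b (PP n (K + 1)) (ex n (j + l - (K * (n - 1) + 1)) (PP n K))) :
    MT n (b⁻¹ * h * a) (PP n (K + 1)) ((PP n (K + 1)).rotate (l + (n - 1))) := by
  have h1 := (hh.ex hn j).mul ha
  rw [ex_rotate2 hn _ _ _ (by rw [PP_length hn]; omega) (by rw [PP_length hn]; omega)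
    (by rw [PP_length hn]; omega), PP_length hn] at h1
  rw [mul_assoc]
  exact (hb.inv.rotate _).mul h1

theorem rot_stage1 {n : ℕ} (hn : 2 ≤ n) {X : ℕ → Tn n} (hX : IsX n X) {c : Tn n}
    (hc : MT n c (PP n 1) ((PP n 1).rotate 1)) {i r : ℕ} (hr : 1 ≤ r) (hir : i + r = n - 1)
    (q : ℕ) :
    MT n ((X (n - 1))⁻¹ ^ (q - 1) * c ^ r * X i ^ q) (PP n (q + 1))
      ((PP n (q + 1)).rotate r) := by
  induction q with
  | zero => simpa using hc.pow_rotate r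
  | succ q ih =>
    have hi : MT n (X i) (PP n (q + 1 + 1)) (ex n i (PP n (q + 1))) :=
      hX i (q + 1) (by rw [add_mul]; omega)
    cases q with
    | zero =>
      have h1 := rot_step1 (j := i) (b := 1) hn ih (by omega) hi (by
        rw [hir]
        have := MT.one n (PP n (1 + 1))
        conv at this => arg 4; rw [PP]
        simpa using this)
      simpa [mul_assoc] using h1
    | succ q =>
      have h1 := rot_step1 (j := i) (b := X (n - 1)) hn ih (by
          rw [add_mul, add_mul]; omega) hi (by
        rw [hir]
        exact hX _ _ (by
          have : (q + 2) * (n - 1) = q * (n - 1) + (n - 1) + (n - 1) := by ring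
          omega))
      have e : (X (n - 1))⁻¹ ^ (q + 1 + 1 - 1) * c ^ r * X i ^ (q + 1 + 1) =
          (X (n - 1))⁻¹ * ((X (n - 1))⁻¹ ^ (q + 1 - 1) * c ^ r * X i ^ (q + 1)) * X i := by
        simp only [Nat.add_sub_cancel]
        rw [pow_succ' _ q, pow_succ _ (q + 1)]
        simp only [mul_assoc]
      rw [e]
      exact h1

theorem rot_stage2 {n : ℕ} (hn : 2 ≤ n) {X : ℕ → Tn n} (hX : IsX n X) {h : Tn n}
    {i q : ℕ} (hi : i < n - 1)
    (hh : MT n h (PP n (q + 1)) ((PP n (q + 1)).rotate (i + 1))) (t : ℕ) :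
    MT n ((X i)⁻¹ ^ t * h * X ((n - 1) * (q + 1)) ^ (t - 1)) (PP n (q + 1 + t))
      ((PP n (q + 1 + t)).rotate (i + 1 + t * (n - 1))) := by
  induction t with
  | zero => simpa using hh
  | succ t ih =>
    have hXi : MT n (X i) (PP n (q + 1 + t + 1)) (ex n i (PP n (q + 1 + t))) :=
      hX i (q + 1 + t) (by rw [add_mul, add_mul]; omega)
    have e0 : (q + 1 + t) * (n - 1) = (n - 1) * (q + 1) + t * (n - 1) := by ring
    have e1 : (n - 1) * (q + 1) + (i + 1 + t * (n - 1)) - ((q + 1 + t) * (n - 1) + 1) = i := by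
      omega
    have e2 : i + 1 + (t + 1) * (n - 1) = i + 1 + t * (n - 1) + (n - 1) := by ring
    have e3 : n - 1 ≤ (n - 1) * (q + 1) := Nat.le_mul_of_pos_right _ (by omega)
    rw [e2, ← add_assoc (q + 1) t 1]
    cases t with
    | zero =>
      have h1 := rot_step2 (j := (n - 1) * (q + 1)) (a := 1) (b := X i) hn ih (by omega)
        (by omega) (by omega) (by
          have := MT.one n (PP n (q + 1 + 1))
          conv at this => arg 4; rw [PP]
          simpa [mul_comm] using this) (by rw [e1]; exact hXi)
      simpa [mul_assoc] using h1
    | succ t =>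
      have h1 := rot_step2 (j := (n - 1) * (q + 1)) (a := X ((n - 1) * (q + 1)))
        (b := X i) hn ih (by omega) (by omega) (by omega)
        (hX _ _ (by rw [e0, add_mul]; omega)) (by rw [e1]; exact hXi)
      have e : (X i)⁻¹ ^ (t + 1 + 1) * h * X ((n - 1) * (q + 1)) ^ (t + 1 + 1 - 1) =
          (X i)⁻¹ * ((X i)⁻¹ ^ (t + 1) * h * X ((n - 1) * (q + 1)) ^ (t + 1 - 1)) *
            X ((n - 1) * (q + 1)) := by
        simp only [Nat.add_sub_cancel]
        rw [pow_succ' _ (t + 1), pow_succ (X ((n - 1) * (q + 1))) t]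
        simp only [mul_assoc]
      rw [e]
      exact h1

theorem X_conj {n : ℕ} (hn : 2 ≤ n) {X : ℕ → Tn n} (hX : IsX n X) {i : ℕ} (hi : i < n - 1)
    (q s : ℕ) :
    X i ^ q * X ((n - 1) * (q + 1)) ^ s = X (n - 1) ^ s * X i ^ q := by
  induction q with
  | zero => simp
  | succ q ih =>
    have h1 : i < (n - 1) * (q + 1) :=
      lt_of_lt_of_le hi (Nat.le_mul_of_pos_right _ (by omega))
    have h2 := X_rel hn hX h1
    have h3 : (n - 1) * (q + 1 + 1) = (n - 1) * (q + 1) + (n - 1) := by ring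
    rw [h3]
    have h4 : X i * X ((n - 1) * (q + 1) + (n - 1)) ^ s = X ((n - 1) * (q + 1)) ^ s * X i :=
      (SemiconjBy.pow_right (show SemiconjBy (X i) _ _ from h2.symm) s)
    rw [pow_succ, mul_assoc, h4, ← mul_assoc, ih, mul_assoc]

/-! ### Words -/

def WL {G : Type*} [Group G] (S : Set G) (g : G) (N : ℕ) : Prop :=
  ∃ w : List G, w.length ≤ N ∧ (∀ x ∈ w, x ∈ S ∨ x⁻¹ ∈ S) ∧ w.prod = g

theorem WL.mul {G : Type*} [Group G] {S : Set G} {g h : G} {N M : ℕ} (hg : WL S g N)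
    (hh : WL S h M) : WL S (g * h) (N + M) := by
  obtain ⟨w, w1, w2, rfl⟩ := hg
  obtain ⟨v, v1, v2, rfl⟩ := hh
  refine ⟨w ++ v, by simp; omega, ?_, by simp⟩
  intro x hx
  rcases List.mem_append.1 hx with h | h
  · exact w2 x h
  · exact v2 x h

theorem WL.pow {G : Type*} [Group G] {S : Set G} {g : G} (hg : g ∈ S) (N : ℕ) :
    WL S (g ^ N) N :=
  ⟨List.replicate N g, by simp, fun x hx => by rw [List.eq_of_mem_replicate hx]; exact Or.inl hg,
    by simp⟩

theorem WL.inv_pow {G : Type*} [Group G] {S : Set G} {g : G} (hg : g ∈ S) (N : ℕ) :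
    WL S (g⁻¹ ^ N) N :=
  ⟨List.replicate N g⁻¹, by simp,
    fun x hx => by rw [List.eq_of_mem_replicate hx]; right; simpa using hg, by simp⟩

theorem WL.mem_closure {G : Type*} [Group G] {S : Set G} {g : G} {N : ℕ} (hg : WL S g N) :
    g ∈ Subgroup.closure S := by
  obtain ⟨w, -, w2, rfl⟩ := hg
  refine Subgroup.list_prod_mem _ fun x hx => ?_
  rcases w2 x hx with h | h
  · exact Subgroup.subset_closure h
  · simpa using Subgroup.inv_mem _ (Subgroup.subset_closure h)

theorem WL.wordLength_le {G : Type*} [Group G] {S : Set G} {g : G} {N : ℕ} (hg : WL S g N) :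
    wordLength S g ≤ N := by
  obtain ⟨w, w1, w2, w3⟩ := hg
  refine le_trans (Nat.sInf_le ?_) w1
  exact ⟨w, rfl, w2, w3⟩

theorem rot_word {n : ℕ} (hn : 2 ≤ n) {X : ℕ → Tn n} (hX : IsX n X) {c : Tn n}
    (hc : MT n c (PP n 1) ((PP n 1).rotate 1)) {S : Set (Tn n)} (hS : ∀ i < n, X i ∈ S)
    (hcS : c ∈ S) (k l : ℕ) (h0 : 0 < l) (hl : l ≤ (k + 1) * (n - 1)) :
    ∃ g, MT n g (PP n (k + 1)) ((PP n (k + 1)).rotate l) ∧ WL S g (2 * k + (n - 1)) := by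
  set t := (l - 1) / (n - 1) with ht
  set i := (l - 1) % (n - 1) with hi
  have hlt : i < n - 1 := Nat.mod_lt _ (by omega)
  have hdm : (n - 1) * t + i = l - 1 := Nat.div_add_mod _ _
  have htk : t < k + 1 := (Nat.div_lt_iff_lt_mul (by omega)).2 (by omega)
  clear_value t i
  obtain ⟨q, rfl⟩ : ∃ q, k = q + t := ⟨k - t, by omega⟩
  obtain ⟨i', hi'⟩ : ∃ i', i' + (i + 1) = n - 1 := ⟨n - 1 - (i + 1), by omega⟩
  have s1 := rot_stage1 hn hX hc (by omega) hi' q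
  have s2 := rot_stage2 hn hX hlt s1 t
  have e1 : i + 1 + t * (n - 1) = l := by rw [mul_comm]; omega
  have e2 : q + 1 + t = q + t + 1 := by ring
  rw [e1, e2] at s2
  refine ⟨_, s2, ?_⟩
  have e3 : (X i)⁻¹ ^ t * ((X (n - 1))⁻¹ ^ (q - 1) * c ^ (i + 1) * X i' ^ q) *
      X ((n - 1) * (q + 1)) ^ (t - 1) =
      (X i)⁻¹ ^ t * ((X (n - 1))⁻¹ ^ (q - 1) * (c ^ (i + 1) * (X (n - 1) ^ (t - 1) * X i' ^ q))) := by
    rw [← X_conj hn hX (by omega : i' < n - 1)]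
    simp only [mul_assoc]
  rw [e3]
  have w := (WL.inv_pow (hS i (by omega)) t).mul ((WL.inv_pow (hS (n - 1) (by omega)) (q - 1)).mul
    ((WL.pow hcS (i + 1)).mul ((WL.pow (hS (n - 1) (by omega)) (t - 1)).mul
      (WL.pow (hS i' (by omega)) q))))
  obtain ⟨w, w1, w2, w3⟩ := w
  exact ⟨w, by omega, w2, w3⟩

/-! ### Expansions -/

inductive Reach (n : ℕ) : List Iv → List Iv → Prop
  | refl (L : List Iv) : Reach n L L
  | step (L M : List Iv) (j : ℕ) : Reach n L M → j < M.length → Reach n L (ex n j M)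

theorem Reach.trans {n : ℕ} {L M N : List Iv} (h1 : Reach n L M) (h2 : Reach n M N) :
    Reach n L N := by
  induction h2 with
  | refl => exact h1
  | step N j _ hj ih => exact Reach.step _ _ _ ih hj

theorem Reach.context {n : ℕ} {L M : List Iv} (A B : List Iv) (h : Reach n L M) :
    Reach n (A ++ (L ++ B)) (A ++ (M ++ B)) := by
  induction h with
  | refl => exact Reach.refl _
  | step N j _ hj ih =>
    have := Reach.step _ _ (A.length + j) ih (by simp; omega)
    rwa [ex_append_right, ex_append_left _ _ _ _ hj] at this

theorem Reach.flatMap {n : ℕ} (D : Iv → List Iv) (hD : ∀ I, Reach n [I] (D I)) (L : List Iv) :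
    Reach n L (L.flatMap D) := by
  induction L with
  | nil => exact Reach.refl _
  | cons I L ih =>
    have h1 := (hD I).context [] L
    have h2 := ih.context (D I) []
    simp only [List.nil_append, List.append_nil, List.flatMap_cons] at h1 h2 ⊢
    exact h1.trans h2

theorem Reach.chain {n : ℕ} (hn : 2 ≤ n) {L M : List Iv} {a b : ℝ} (h : Reach n L M)
    (hL : Chain n a L b) : Chain n a M b := by
  induction h with
  | refl => exact hL
  | step N j _ hj ih => exact ih.ex hn j

def desc (n : ℕ) : ℕ → Iv → List Iv
  | 0, I => [I]
  | d + 1, I => (ch n I).flatMap (desc n d)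

theorem reach_desc (n d : ℕ) (I : Iv) : Reach n [I] (desc n d I) := by
  induction d generalizing I with
  | zero => exact Reach.refl _
  | succ d ih =>
    have h1 : Reach n [I] (ch n I) := by
      have := Reach.step _ _ 0 (Reach.refl (n := n) [I]) (by simp)
      simpa [ex] using this
    exact h1.trans (Reach.flatMap _ ih _)

theorem desc_depth (n d : ℕ) (I J : Iv) (h : J ∈ desc n d I) : J.2 = I.2 + d := by
  induction d generalizing I with
  | zero =>
    simp only [desc, List.mem_singleton] at h
    simp [h]
  | succ d ih =>
    simp only [desc, List.mem_flatMap, ch, List.mem_map] at h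
    obtain ⟨_, ⟨u, hu, rfl⟩, h⟩ := h
    rw [ih _ h]; simp; omega

theorem chain_unique {n : ℕ} (hn : 2 ≤ n) {a b : ℝ} {r : ℕ} {L M : List Iv}
    (hL : Chain n a L b) (hM : Chain n a M b) (dL : ∀ I ∈ L, I.2 = r)
    (dM : ∀ I ∈ M, I.2 = r) : L = M := by
  have aux : ∀ (c d : ℝ) (I : Iv) (N : List Iv), Chain n c (I :: N) d → c < d := by
    intro c d I N h
    have h1 := h.2.le hn
    have h2 := pt_lt hn I zero_lt_one
    rw [h.1] at h2
    linarith
  induction L generalizing M a with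
  | nil =>
    cases M with
    | nil => rfl
    | cons J M =>
      have := aux _ _ _ _ hM
      have h : a = b := hL
      linarith
  | cons I L ih =>
    cases M with
    | nil =>
      have := aux _ _ _ _ hL
      have h : a = b := hM
      linarith
    | cons J M =>
      have hIJ : I = J := by
        have e1 := dL I (by simp)
        have e2 := dM J (by simp)
        have e3 := hL.1.trans hM.1.symm
        have hp : (0 : ℝ) < (n : ℝ) ^ r := by positivity
        simp only [pt, e1, e2, add_zero] at e3
        rw [div_left_inj' hp.ne'] at e3
        exact Prod.ext (by exact_mod_cast e3) (e1.trans e2.symm)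
      subst hIJ
      rw [ih hL.2 hM.2 (fun K hK => dL K (by simp [hK])) (fun K hK => dM K (by simp [hK]))]

/-! ### Generation -/

theorem X_mem {n : ℕ} (hn : 2 ≤ n) {X : ℕ → Tn n} (hX : IsX n X) {G : Subgroup (Tn n)}
    (hG : ∀ i < n, X i ∈ G) (j : ℕ) : X j ∈ G := by
  induction j using Nat.strong_induction_on with
  | _ j ih =>
    by_cases h : j < n
    · exact hG j h
    · have h1 := X_rel hn hX (i := 0) (j := j - (n - 1)) (by omega)
      have e : j - (n - 1) + (n - 1) = j := by omega
      rw [e] at h1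
      have : X j = (X 0)⁻¹ * (X (j - (n - 1)) * X 0) := by rw [h1]; simp
      rw [this]
      exact G.mul_mem (G.inv_mem (hG 0 (by omega))) (G.mul_mem (ih _ (by omega)) (hG 0 (by omega)))

theorem Y_mem {n : ℕ} (hn : 2 ≤ n) {X : ℕ → Tn n} (hX : IsX n X) {G : Subgroup (Tn n)}
    (hG : ∀ i < n, X i ∈ G) (j K : ℕ) (hj : j ≤ K * (n - 1)) :
    ∃ y ∈ G, MT n y (PP n (K + 1)) (ex n j (PP n K)) := by
  rcases hj.eq_or_lt with h | h
  · exact ⟨1, G.one_mem, by rw [h]; exact MT.one n _⟩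
  · exact ⟨X j, X_mem hn hX hG j, hX j K h⟩

def Good (n : ℕ) (G : Subgroup (Tn n)) (L : List Iv) : Prop :=
  ∃ K, ∃ h ∈ G, MT n h (PP n K) L

theorem good_ex {n : ℕ} (hn : 2 ≤ n) {X : ℕ → Tn n} (hX : IsX n X) {G : Subgroup (Tn n)}
    (hG : ∀ i < n, X i ∈ G) {L : List Iv} {j : ℕ} (hj : j < L.length) :
    Good n G L ↔ Good n G (ex n j L) := by
  constructor
  · rintro ⟨K, h, hh, hm⟩
    have hl := List.Forall₂.length_eq hm
    rw [PP_length hn] at hl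
    obtain ⟨y, hy, hym⟩ := Y_mem hn hX hG j K (by omega)
    exact ⟨K + 1, h * y, G.mul_mem hh hy, (hm.ex hn j).mul hym⟩
  · rintro ⟨K, h, hh, hm⟩
    have hl := List.Forall₂.length_eq hm
    rw [PP_length hn, ex_length hn _ _ hj] at hl
    cases K with
    | zero => omega
    | succ K =>
      have e : (K + 1) * (n - 1) = K * (n - 1) + (n - 1) := by ring
      obtain ⟨y, hy, hym⟩ := Y_mem hn hX hG j K (by omega)
      exact ⟨K, h * y⁻¹, G.mul_mem hh (G.inv_mem hy),
        Maps.of_ex hn j (hm.mul hym.inv) (by rw [PP_length hn]; omega)⟩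

theorem good_reach {n : ℕ} (hn : 2 ≤ n) {X : ℕ → Tn n} (hX : IsX n X) {G : Subgroup (Tn n)}
    (hG : ∀ i < n, X i ∈ G) {L M : List Iv} (h : Reach n L M) : Good n G L ↔ Good n G M := by
  induction h with
  | refl => exact Iff.rfl
  | step N j _ hj ih => exact ih.trans (good_ex hn hX hG hj)

theorem good_desc {n : ℕ} (hn : 2 ≤ n) {X : ℕ → Tn n} (hX : IsX n X) {G : Subgroup (Tn n)}
    (hG : ∀ i < n, X i ∈ G) (r : ℕ) : Good n G (desc n r (0, 0)) :=
  (good_reach hn hX hG (reach_desc n r (0, 0))).1 ⟨0, 1, G.one_mem, MT.one n _⟩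

theorem chain_root (n : ℕ) : Chain n 0 [(0, 0)] 1 := by simp [Chain, pt]

theorem chain_desc {n : ℕ} (hn : 2 ≤ n) (r : ℕ) : Chain n 0 (desc n r (0, 0)) 1 :=
  (reach_desc n r (0, 0)).chain hn (chain_root n)

theorem good_chain {n : ℕ} (hn : 2 ≤ n) {X : ℕ → Tn n} (hX : IsX n X) {G : Subgroup (Tn n)}
    (hG : ∀ i < n, X i ∈ G) {L : List Iv} (hL : Chain n 0 L 1) : Good n G L := by
  obtain ⟨r, hr⟩ : ∃ r, ∀ I ∈ L, I.2 ≤ r := by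
    clear hL
    induction L with
    | nil => exact ⟨0, by simp⟩
    | cons I L ih =>
      obtain ⟨r, hr⟩ := ih
      refine ⟨max I.2 r, ?_⟩
      intro J hJ
      rcases List.mem_cons.1 hJ with rfl | h
      · exact le_max_left _ _
      · exact (hr J h).trans (le_max_right _ _)
  have h1 : Reach n L (L.flatMap fun I => desc n (r - I.2) I) :=
    Reach.flatMap _ (fun I => reach_desc n _ I) L
  have h2 : L.flatMap (fun I => desc n (r - I.2) I) = desc n r (0, 0) := by
    refine chain_unique hn (r := r) (h1.chain hn hL) (chain_desc hn r) ?_ ?_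
    · intro J hJ
      obtain ⟨I, hI, hJ⟩ := List.mem_flatMap.1 hJ
      rw [desc_depth _ _ _ _ hJ]
      have := hr I hI
      omega
    · intro J hJ
      rw [desc_depth _ _ _ _ hJ]; simp
  rw [good_reach hn hX hG h1, h2]
  exact good_desc hn hX hG r

/-! ### Chains crossing integers -/

def shiftIv (n : ℕ) (z : ℤ) (I : Iv) : Iv := (I.1 + z * (n : ℤ) ^ I.2, I.2)

theorem pt_shift {n : ℕ} (hn : 2 ≤ n) (z : ℤ) (I : Iv) (y : ℝ) :
    pt n (shiftIv n z I) y = pt n I y + z := by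
  have : (0 : ℝ) < n := by positivity
  simp only [pt, shiftIv]
  push_cast
  field_simp
  ring

theorem Chain.shift {n : ℕ} (hn : 2 ≤ n) {a b : ℝ} {L : List Iv} (h : Chain n a L b) (z : ℤ) :
    Chain n (a + z) (L.map (shiftIv n z)) (b + z) := by
  induction L generalizing a with
  | nil => have : a = b := h; simp [Chain, this]
  | cons I L ih =>
    refine ⟨by rw [pt_shift hn, h.1], ?_⟩
    rw [pt_shift hn]
    exact ih h.2

theorem Maps.shift {n : ℕ} (hn : 2 ≤ n) {f : Circle → Circle} {L M : List Iv}
    (h : Maps n f L M) (z : ℤ) : Maps n f L (M.map (shiftIv n z)) := by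
  rw [Maps, List.forall₂_map_right_iff]
  refine List.Forall₂.imp ?_ h
  intro I J hIJ y hy
  rw [hIJ y hy, pt_shift hn]
  exact (coe_eq_iff _ _).2 ⟨z, rfl⟩

theorem Chain.split {n : ℕ} (hn : 2 ≤ n) {a b : ℝ} {L : List Iv} (h : Chain n a L b) (z : ℤ)
    (h0 : a ≤ z) (h1 : (z : ℝ) ≤ b) :
    ∃ A B, L = A ++ B ∧ Chain n a A z ∧ Chain n z B b := by
  induction L generalizing a with
  | nil =>
    have : a = b := h
    refine ⟨[], [], rfl, ?_, ?_⟩ <;> simp only [Chain] <;> linarith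
  | cons I L ih =>
    rcases h0.eq_or_lt with h2 | h2
    · exact ⟨[], I :: L, rfl, h2, by rw [← h2]; exact h⟩
    · have h3 : pt n I 1 ≤ z := by
        have hp : (0 : ℝ) < (n : ℝ) ^ I.2 := by positivity
        have h4 := h.1
        rw [← h4] at h2
        simp only [pt, add_zero] at h2 ⊢
        rw [div_lt_iff₀ hp] at h2
        rw [div_le_iff₀ hp]
        have h5 : I.1 < z * (n : ℤ) ^ I.2 := by exact_mod_cast h2
        have h6 : I.1 + 1 ≤ z * (n : ℤ) ^ I.2 := h5
        exact_mod_cast h6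
      obtain ⟨A, B, e, hA, hB⟩ := ih h.2 h3
      exact ⟨I :: A, B, by rw [e]; rfl, ⟨h.1, hA⟩, hB⟩

/-! ### Elements of `T_n` and standard subdivisions -/

theorem Chain.image {n : ℕ} {F : ℝ → ℝ} {L : List Iv} {a b : ℝ} (h : Chain n a L b)
    (hF : ∀ I ∈ L, ∃ J : Iv, ∀ y ∈ Set.Icc (0 : ℝ) 1, F (pt n I y) = pt n J y) :
    ∃ M : List Iv, List.Forall₂ (fun I J => ∀ y ∈ Set.Icc (0 : ℝ) 1, F (pt n I y) = pt n J y) L M ∧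
      Chain n (F a) M (F b) := by
  induction L generalizing a with
  | nil =>
    have : a = b := h
    exact ⟨[], List.Forall₂.nil, by simp [Chain, this]⟩
  | cons I L ih =>
    obtain ⟨J, hJ⟩ := hF I (by simp)
    obtain ⟨M, h1, h2⟩ := ih h.2 fun K hK => hF K (by simp [hK])
    refine ⟨J :: M, List.Forall₂.cons hJ h1, ?_, ?_⟩
    · rw [← hJ 0 (by simp), h.1]
    · rw [← hJ 1 (by simp)]; exact h2

theorem piece {n : ℕ} (hn : 2 ≤ n) {t₁ c : ℝ} (σ : ℤ) (ht₁ : IsNAdic n t₁) (hc : IsNAdic n c) :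
    ∃ N : ℕ, ∀ r ≥ N, ∀ i : ℤ, (i : ℝ) / (n : ℝ) ^ r < t₁ →
      ((i : ℝ) + 1) / (n : ℝ) ^ r ≤ t₁ ∧
      ∃ J : Iv, ∀ y : ℝ, (n : ℝ) ^ σ * pt n (i, r) y + c = pt n J y := by
  have hn0 : (0 : ℝ) < n := by positivity
  obtain ⟨b, e, rfl⟩ := ht₁
  obtain ⟨d, e', rfl⟩ := hc
  refine ⟨e + e' + σ.toNat, ?_⟩
  intro r hr i hi
  constructor
  · obtain ⟨s, rfl⟩ : ∃ s, r = e + s := ⟨r - e, by omega⟩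
    rw [pow_add] at hi ⊢
    rw [div_lt_div_iff₀ (by positivity) (by positivity)] at hi
    rw [div_le_div_iff₀ (by positivity) (by positivity)]
    have h1 : (i : ℝ) < b * (n : ℝ) ^ s := by
      have : (0 : ℝ) < (n : ℝ) ^ e := by positivity
      nlinarith
    have h2 : i < b * (n : ℤ) ^ s := by exact_mod_cast h1
    have h3 : i + 1 ≤ b * (n : ℤ) ^ s := h2
    have h4 : (i : ℝ) + 1 ≤ b * (n : ℝ) ^ s := by exact_mod_cast h3
    have : (0 : ℝ) < (n : ℝ) ^ e := by positivity
    nlinarith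
  · obtain ⟨s, hs⟩ : ∃ s : ℕ, (s : ℤ) = r - σ - e' := ⟨(r - σ - e').toNat, by omega⟩
    refine ⟨(i + d * (n : ℤ) ^ s, s + e'), ?_⟩
    intro y
    have e1 : σ = (r : ℤ) - ((s + e' : ℕ) : ℤ) := by push_cast; omega
    rw [e1, zpow_sub₀ hn0.ne', zpow_natCast, zpow_natCast]
    simp only [pt]
    push_cast
    rw [pow_add]
    field_simp
    ring

theorem exists_piece (m : ℕ) (t : ℕ → ℝ) (x : ℝ) (h0 : t 0 ≤ x) (h1 : x < t m) :
    ∃ p < m, t p ≤ x ∧ x < t (p + 1) := by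
  induction m with
  | zero => linarith
  | succ m ih =>
    by_cases h : x < t m
    · obtain ⟨p, hp, h2⟩ := ih h
      exact ⟨p, by omega, h2⟩
    · exact ⟨m, by omega, le_of_not_gt h, h1⟩

theorem InT.subdiv {n : ℕ} (hn : 2 ≤ n) {f : Circle ≃ₜ Circle} (hf : InT n f) :
    ∃ (r : ℕ) (M : List Iv) (a : ℝ), Maps n f (desc n r (0, 0)) M ∧ Chain n a M (a + 1) := by
  have hn0 : (0 : ℝ) < n := by positivity
  obtain ⟨hN, F, hF1, hF2, hF3, m, t, σ, c, hm, ht0, htm, hts, htn, haff⟩ := hf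
  have hFt : ∀ p, p < m → IsNAdic n (c p) := by
    intro p hp
    have h1 : IsNAdic n (F (t p)) := by
      rw [← coe_mem_nAdic hn, ← hF2, ← hN]
      exact ⟨_, (coe_mem_nAdic hn _).2 (htn p hp.le), rfl⟩
    have h2 := haff p hp (t p) ⟨le_rfl, (hts p hp).le⟩
    have h3 : c p = F (t p) + -((n : ℝ) ^ (σ p) * t p) := by rw [h2]; ring
    rw [h3]
    refine h1.add hn (IsNAdic.neg ?_)
    rcases Int.eq_nat_or_neg (σ p) with ⟨k, h | h⟩
    · rw [h, zpow_natCast, mul_comm]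
      exact (htn p hp.le).mul k
    · rw [h, zpow_neg, zpow_natCast, mul_comm, ← div_eq_mul_inv]
      exact (htn p hp.le).div hn k
  have hN' : ∀ p : ℕ, ∃ N : ℕ, p < m → ∀ r ≥ N, ∀ i : ℤ, (i : ℝ) / (n : ℝ) ^ r < t (p + 1) →
      ((i : ℝ) + 1) / (n : ℝ) ^ r ≤ t (p + 1) ∧
      ∃ J : Iv, ∀ y : ℝ, (n : ℝ) ^ (σ p) * pt n (i, r) y + c p = pt n J y := by
    intro p
    by_cases hp : p < m
    · obtain ⟨N, h⟩ := piece hn (σ p) (htn (p + 1) hp) (hFt p hp)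
      exact ⟨N, fun _ => h⟩
    · exact ⟨0, fun h => absurd h hp⟩
  choose N hN2 using hN'
  set r := (Finset.range m).sup N with hr
  have hrN : ∀ p < m, N p ≤ r := fun p hp => Finset.le_sup (f := N) (Finset.mem_range.2 hp)
  have hch := chain_desc hn r
  obtain ⟨M, hM1, hM2⟩ := hch.image (F := F) (by
    intro I hI
    have hd := desc_depth _ _ _ _ hI
    rw [zero_add] at hd
    have hI2 := hch.mem hn hI
    have hlt := pt_lt hn I zero_lt_one
    obtain ⟨p, hp, h1, h2⟩ := exists_piece m t (pt n I 0) (by rw [ht0]; exact hI2.1)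
      (by rw [htm]; linarith)
    have hIe : I = (I.1, r) := Prod.ext rfl hd
    obtain ⟨h3, J, hJ⟩ := hN2 p hp r (hrN p hp) I.1 (by
      have : pt n I 0 = (I.1 : ℝ) / (n : ℝ) ^ r := by simp [pt, hd]
      rwa [this] at h2)
    refine ⟨J, ?_⟩
    intro y hy
    rw [← hJ y, ← hIe]
    have hmono : Monotone (pt n I) :=
      (show StrictMono (pt n I) from fun _ _ h => pt_lt hn I h).monotone
    refine haff p hp _ ⟨h1.trans (hmono hy.1), (hmono hy.2).trans ?_⟩
    have : pt n I 1 = ((I.1 : ℝ) + 1) / (n : ℝ) ^ r := by simp [pt, hd]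
    rw [this]; exact h3)
  refine ⟨r, M, F 0, ?_, ?_⟩
  · refine List.Forall₂.imp ?_ hM1
    intro I J h y hy
    rw [hF2, h y hy]
  · have := hF3 0
    rw [zero_add] at this
    rwa [← this]

theorem generation {n : ℕ} (hn : 2 ≤ n) {X : ℕ → Tn n} (hX : IsX n X) {c : Tn n}
    (hc : MT n c (PP n 1) ((PP n 1).rotate 1)) {S : Set (Tn n)} (hS : ∀ i < n, X i ∈ S)
    (hcS : c ∈ S) : Subgroup.closure S = ⊤ := by
  set G := Subgroup.closure S with hGdef
  have hG : ∀ i < n, X i ∈ G := fun i hi => Subgroup.subset_closure (hS i hi)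
  have key : ∀ (f : Circle ≃ₜ Circle) (hf : f ∈ TnSet n),
      (⟨f, Subgroup.subset_closure hf⟩ : Tn n) ∈ G := by
    intro f hf
    obtain ⟨r, M, a, h1, h2⟩ := InT.subdiv hn hf
    have h1' : MT n ⟨f, Subgroup.subset_closure hf⟩ (desc n r (0, 0)) M := h1
    obtain ⟨A, B, rfl, hA, hB⟩ := h2.split hn ⌈a⌉ (Int.le_ceil a) (Int.ceil_lt_add_one a).le
    have hA' := hA.shift hn (1 - ⌈a⌉)
    have hB' := hB.shift hn (-⌈a⌉)
    have hAB : Chain n 0 (B.map (shiftIv n (-⌈a⌉)) ++ A.map (shiftIv n (1 - ⌈a⌉))) 1 := by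
      push_cast at hA' hB'
      have e1 : (⌈a⌉ : ℝ) + -(⌈a⌉ : ℝ) = 0 := by ring
      have e2 : a + 1 + -(⌈a⌉ : ℝ) = a + (1 - ⌈a⌉) := by ring
      have e3 : (⌈a⌉ : ℝ) + (1 - (⌈a⌉ : ℝ)) = 1 := by ring
      rw [e1, e2] at hB'
      rw [e3] at hA'
      exact hB'.append hA'
    obtain ⟨K, h, hh, hm⟩ := good_chain hn hX hG hAB
    obtain ⟨K', g, hg, hgm⟩ := good_desc hn hX hG r
    have m1 := h1'.mul hgm
    have l1 := List.Forall₂.length_eq m1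
    have l2 := List.Forall₂.length_eq hm
    rw [PP_length hn] at l1 l2
    simp only [List.length_append, List.length_map] at l1 l2
    have hK : K' = K := by
      have : K' * (n - 1) = K * (n - 1) := by omega
      exact Nat.eq_of_mul_eq_mul_right (by omega) this
    subst hK
    have m2 := m1.rotate A.length
    rw [List.rotate_append_length_eq] at m2
    obtain ⟨ρ, hρ, hρm⟩ : ∃ ρ ∈ G, MT n ρ (PP n K') ((PP n K').rotate A.length) := by
      by_cases hA0 : A.length = 0
      · exact ⟨1, G.one_mem, by rw [hA0, List.rotate_zero]; exact MT.one n _⟩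
      · by_cases hA1 : A.length = K' * (n - 1) + 1
        · refine ⟨1, G.one_mem, ?_⟩
          rw [hA1, ← PP_length hn, List.rotate_length]
          exact MT.one n _
        · cases K' with
          | zero => omega
          | succ k =>
            obtain ⟨g, hg1, hg2⟩ := rot_word hn hX hc hS hcS k A.length (by omega) (by omega)
            exact ⟨g, hg2.mem_closure, hg1⟩
    have m3 := m2.mul hρm
    have m4 : MT n (⟨f, Subgroup.subset_closure hf⟩ * g * ρ) (PP n K')
        (B.map (shiftIv n (-⌈a⌉)) ++ A.map (shiftIv n (1 - ⌈a⌉))) := by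
      have hs : (PP n K').length = (B ++ A).length := List.Forall₂.length_eq m3
      have hsp : PP n K' = (PP n K').take B.length ++ (PP n K').drop B.length :=
        (List.take_append_drop _ _).symm
      have m3' : Maps n _ _ _ := m3
      rw [hsp] at m3'
      have := forall2_append_inv m3' (by
        rw [List.length_append] at hs
        simp; omega)
      have := Maps.append (Maps.shift hn this.1 (-⌈a⌉)) (Maps.shift hn this.2 (1 - ⌈a⌉))
      rw [← hsp] at this
      exact this
    have e := m4.ext hn (chain_PP hn _) hm
    have e' : (⟨f, Subgroup.subset_closure hf⟩ : Tn n) = h * ρ⁻¹ * g⁻¹ := by rw [← e]; group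
    rw [e']
    exact G.mul_mem (G.mul_mem hh (G.inv_mem hρ)) (G.inv_mem hg)
  have h1 : Tn n ≤ G.map (Tn n).subtype := by
    refine (Subgroup.closure_le _).2 ?_
    intro f hf
    exact ⟨_, key f hf, rfl⟩
  rw [eq_top_iff]
  intro x _
  obtain ⟨y, hy, e⟩ := h1 x.2
  have : y = x := Subtype.ext e
  rwa [← this]

/-! ### The rotations and the final statement -/

def pL (n j : ℕ) : Iv :=
  ((n : ℤ) ^ (j / (n - 1) + 1) - n + ((j % (n - 1) : ℕ) : ℤ), j / (n - 1) + 1)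

theorem PP_eq {n : ℕ} (hn : 2 ≤ n) (K : ℕ) :
    PP n K = (List.range (K * (n - 1))).map (pL n) ++ [((n : ℤ) ^ K - 1, K)] := by
  induction K with
  | zero => simp [PP]
  | succ K ih =>
    have h := ex_append_right n 0 ((List.range (K * (n - 1))).map (pL n)) [((n : ℤ) ^ K - 1, K)]
    simp only [List.length_map, List.length_range, Nat.add_zero] at h
    rw [PP, ih, h, Nat.succ_mul, List.range_add, List.map_append, List.append_assoc]
    congr 1
    obtain ⟨m, rfl⟩ : ∃ m, n = m + 2 := ⟨n - 2, by omega⟩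
    simp only [ex, ch, List.append_nil]
    rw [List.range_succ, List.map_append, show m + 2 - 1 = m + 1 by omega]
    congr 1
    · rw [List.map_map]
      apply List.map_congr_left
      intro u hu
      have hu' : u < m + 1 := by simpa using hu
      have e1 : (K * (m + 1) + u) / (m + 1) = K := by
        rw [Nat.mul_comm, Nat.mul_add_div (by omega), Nat.div_eq_of_lt hu']; rfl
      have e2 : (K * (m + 1) + u) % (m + 1) = u := by
        rw [Nat.mul_comm, Nat.mul_add_mod, Nat.mod_eq_of_lt hu']
      simp only [pL, Function.comp, show m + 2 - 1 = m + 1 by omega, e1, e2]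
      ext
      · push_cast; ring
      · rfl
    · simp only [List.map_cons, List.map_nil, List.cons.injEq, Prod.mk.injEq, and_true]
      push_cast; ring

theorem Chain.next {n : ℕ} {a b : ℝ} {L : List Iv} (h : Chain n a L b) (j : ℕ)
    (hj : j < L.length) :
    (∀ h1 : j + 1 < L.length, pt n L[j] 1 = pt n L[j + 1] 0) ∧
      (j + 1 = L.length → pt n L[j] 1 = b) := by
  induction L generalizing a j with
  | nil => simp at hj
  | cons I L ih =>
    cases j with
    | zero =>
      cases L with
      | nil =>
        refine ⟨fun h1 => by simp at h1, fun _ => h.2⟩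
      | cons J L =>
        exact ⟨fun _ => h.2.1.symm, fun h1 => by simp at h1⟩
    | succ j =>
      have := ih h.2 j (by simpa using hj)
      refine ⟨fun h1 => ?_, fun h1 => ?_⟩
      · simpa using this.1 (by simpa using h1)
      · simpa using this.2 (by simpa using h1)

theorem pt_left {n : ℕ} (hn : 2 ≤ n) (k j : ℕ) (hj : j < (PP n (k + 1)).length) :
    pt n (PP n (k + 1))[j] 0 = ckPt n k j := by
  have hl := PP_length hn (k + 1)
  have h0 : (n : ℝ) ≠ 0 := by positivity
  have hne : j ≠ (k + 1) * (n - 1) + 1 := by omega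
  simp only [PP_eq hn (k + 1), ckPt, if_neg hne]
  by_cases h : j < (k + 1) * (n - 1)
  · rw [List.getElem_append_left (by simpa using h)]
    simp only [List.getElem_map, List.getElem_range, pL, pt]
    generalize j / (n - 1) = q
    generalize j % (n - 1) = r
    push_cast
    simp only [zpow_neg, zpow_add₀ h0, zpow_natCast, zpow_one]
    field_simp
    ring
  · have hj' : j = (k + 1) * (n - 1) := by omega
    subst hj'
    have e1 : (k + 1) * (n - 1) / (n - 1) = k + 1 := Nat.mul_div_cancel _ (by omega)
    have e2 : (k + 1) * (n - 1) % (n - 1) = 0 := Nat.mul_mod_left _ _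
    rw [List.getElem_append_right (by simp)]
    simp only [List.length_map, List.length_range, Nat.sub_self, List.getElem_cons_zero, e1, e2, pt]
    rw [zpow_neg, zpow_natCast]
    push_cast
    field_simp
    ring

theorem pt_right {n : ℕ} (hn : 2 ≤ n) (k j : ℕ) (hj : j < (PP n (k + 1)).length) :
    pt n (PP n (k + 1))[j] 1 = ckPt n k (j + 1) := by
  have hl := PP_length hn (k + 1)
  have := (chain_PP hn (k + 1)).next j hj
  by_cases h : j + 1 < (PP n (k + 1)).length
  · rw [this.1 h, pt_left hn]
  · rw [this.2 (by omega), ckPt, if_pos (by omega)]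

theorem IsCk.maps {n : ℕ} (hn : 2 ≤ n) {k : ℕ} {f : Circle ≃ₜ Circle} (h : IsCk n k f) :
    Maps n f (PP n (k + 1)) ((PP n (k + 1)).rotate 1) := by
  have hl := PP_length hn (k + 1)
  rw [Maps, List.forall₂_iff_get]
  refine ⟨by simp, fun j h1 h2 => ?_⟩
  simp only [List.get_eq_getElem, List.getElem_rotate]
  intro y hy
  have hm : (j + 1) % (PP n (k + 1)).length < (PP n (k + 1)).length := Nat.mod_lt _ (by omega)
  have a0 := pt_left hn k j h1
  have a1 := pt_right hn k j h1
  have b0 := pt_left hn k _ hm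
  have b1 := pt_right hn k _ hm
  have key := h j (by omega) (pt n (PP n (k + 1))[j] y) (by
    rw [← a0, ← a1]
    constructor
    · unfold pt; gcongr; exact hy.1
    · unfold pt; gcongr; exact hy.2)
  rw [key]
  rw [← hl, ← b0, ← b1, ← a0, ← a1]
  congr 1
  have h0 : (n : ℝ) ≠ 0 := by positivity
  generalize (PP n (k + 1))[j] = I
  generalize (PP n (k + 1))[(j + 1) % (PP n (k + 1)).length] = J
  simp only [pt]
  field_simp
  ring

theorem Maps.head {n : ℕ} {f : Circle → Circle} {L M : List Iv} {a b a' b' : ℝ}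
    (h : Maps n f L M) (hL : Chain n a L b) (hM : Chain n a' M b') (hne : L ≠ []) :
    f (a : Circle) = (a' : Circle) := by
  cases h with
  | nil => exact absurd rfl hne
  | cons h1 h2 =>
    have := h1 0 (by simp)
    rwa [hL.1, hM.1] at this

theorem exists_c {n : ℕ} (hn : 2 ≤ n) :
    ∃ c : Tn n, MT n c (PP n 1) ((PP n 1).rotate 1) ∧
      (c : Circle ≃ₜ Circle) ((0 : ℝ) : Circle) = ((1 / n : ℝ) : Circle) := by
  have hn0 : (n : ℝ) ≠ 0 := by positivity
  have hch := chain_PP hn 1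
  have hPP : PP n 1 = (0, 1) :: (PP n 1).tail := by
    obtain ⟨m, rfl⟩ : ∃ m, n = m + 2 := ⟨n - 2, by omega⟩
    simp [PP, ex, ch, List.range_succ_eq_map]
  set R := (PP n 1).tail with hR
  rw [hPP] at hch ⊢
  have hR1 : Chain n (1 / n) R 1 := by
    have := hch.2
    simpa [pt] using this
  have hlast : Chain n 1 [shiftIv n 1 (0, 1)] (1 / n + 1) := by
    refine ⟨?_, ?_⟩
    · rw [pt_shift hn]; simp [pt]
    · rw [Chain, pt_shift hn]; simp [pt]
  have hM : Chain n (1 / n) (R ++ [shiftIv n 1 (0, 1)]) (1 / n + 1) := hR1.append hlast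
  obtain ⟨f, hf, hm⟩ := exists_T hn ((0, 1) :: R) (R ++ [shiftIv n 1 (0, 1)]) (by simp) _ hch hM
  refine ⟨⟨f, Subgroup.subset_closure hf⟩, ?_, hm.head hch hM (by simp)⟩
  show Maps n f _ _
  rw [List.rotate_cons_succ, List.rotate_zero]
  rw [Maps, List.forall₂_iff_get] at hm ⊢
  refine ⟨by simp, fun j h1 h2 => ?_⟩
  have := hm.2 j h1 (by simpa using h2)
  simp only [List.get_eq_getElem] at this ⊢
  by_cases hj : j < R.length
  · rw [List.getElem_append_left hj] at this ⊢
    exact this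
  · rw [List.getElem_append_right (by omega)] at this ⊢
    simp only [List.getElem_singleton] at this ⊢
    intro y hy
    rw [this y hy, pt_shift hn]
    exact ((coe_eq_iff _ _).2 ⟨1, rfl⟩).symm

theorem X_ne {n : ℕ} (hn : 2 ≤ n) {X : ℕ → Tn n} (hX : IsX n X) {i j : ℕ} (hij : i < j) :
    X i ≠ X j := by
  intro he
  have hn0 : (0 : ℝ) < n := by positivity
  set K := j + 1 with hKd
  have hK : j < K * (n - 1) := by
    have : 1 ≤ n - 1 := by omega
    nlinarith
  have a1 := hX i K (by omega)
  have a2 := hX j K hK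
  rw [← he] at a2
  have hl := PP_length hn K
  obtain ⟨A, I, B, hA, hPP⟩ : ∃ A I B, A.length = i ∧ PP n K = A ++ I :: B :=
    ⟨(PP n K).take i, (PP n K)[i]'(by omega), (PP n K).drop (i + 1), by
      rw [List.length_take]; omega, by simp⟩
  have ea : ∀ t, ex n (i + (t + 1)) (PP n K) = A ++ I :: ex n t B := by
    intro t
    rw [hPP, ← hA, ex_append_right]; rfl
  have e0 : ex n i (PP n K) = A ++ (ch n I ++ B) := by
    have := ex_append_right n 0 A (I :: B)
    rw [Nat.add_zero, hA] at this
    rw [hPP, this]; rfl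
  have e1 := ea (j - i - 1)
  rw [show i + (j - i - 1 + 1) = j by omega] at e1
  have e2 := ea (K * (n - 1) - i - 1)
  rw [show i + (K * (n - 1) - i - 1 + 1) = K * (n - 1) by omega] at e2
  rw [show PP n (K + 1) = ex n (K * (n - 1)) (PP n K) from rfl, e2] at a1 a2
  rw [e0] at a1
  rw [e1] at a2
  have b1 := (forall2_append_inv a1 rfl).2
  have b2 := (forall2_append_inv a2 rfl).2
  obtain ⟨m, rfl⟩ : ∃ m, n = m + 2 := ⟨n - 2, by omega⟩
  rw [ch, List.range_succ_eq_map, List.map_cons, List.cons_append] at b1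
  have c1 := (List.forall₂_cons.1 b1).1 1 (by simp)
  have c2 := (List.forall₂_cons.1 b2).1 1 (by simp)
  rw [c1] at c2
  have d1 := pt_child hn I 0 1
  rw [d1] at c2
  obtain ⟨z, hz⟩ := (coe_eq_iff _ _).1 c2
  have hN : (2 : ℝ) ≤ ((m + 2 : ℕ) : ℝ) := by exact_mod_cast hn
  have f0 : (0 : ℝ) < 1 / ((m + 2 : ℕ) : ℝ) := by positivity
  have f1 : (1 : ℝ) / ((m + 2 : ℕ) : ℝ) < 1 := by rw [div_lt_one (by linarith)]; linarith
  have f2 := pt_lt hn I f1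
  rw [Nat.cast_zero, zero_add] at hz
  have f3 : pt (m + 2) I 1 - pt (m + 2) I (1 / ((m + 2 : ℕ) : ℝ)) < 1 := by
    have g1 : (1 : ℝ) ≤ ((m + 2 : ℕ) : ℝ) ^ I.2 := one_le_pow₀ (by linarith)
    simp only [pt]
    rw [← sub_div, div_lt_one (by linarith)]
    linarith
  have h5 : (z : ℝ) < 1 := by linarith
  have h6 : (0 : ℝ) < z := by linarith
  have h7 : z < 1 := by exact_mod_cast h5
  have h8 : 0 < z := by exact_mod_cast h6
  omega

theorem X_ne_c {n : ℕ} (hn : 2 ≤ n) {X : ℕ → Tn n} (hX : IsX n X) {c : Tn n}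
    (hc : (c : Circle ≃ₜ Circle) ((0 : ℝ) : Circle) = ((1 / n : ℝ) : Circle)) (j : ℕ) :
    c ≠ X j := by
  intro he
  have hK : j < (j + 1) * (n - 1) := by
    have : 1 ≤ n - 1 := by omega
    nlinarith
  have h := Maps.head (hX j (j + 1) hK) (chain_PP hn _) ((chain_PP hn (j + 1)).ex hn j)
    (by intro h; have := PP_length hn (j + 1 + 1); rw [h] at this; simp at this)
  rw [← he] at h
  rw [h] at hc
  obtain ⟨z, hz⟩ := (coe_eq_iff _ _).1 hc
  have h2 : (2 : ℝ) ≤ n := by exact_mod_cast hn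
  have h3 : (1 / n : ℝ) < 1 := by rw [div_lt_one (by linarith)]; linarith
  have h4 : (0 : ℝ) < 1 / n := by positivity
  rw [hz, zero_add] at h3 h4
  have h5 : z < 1 := by exact_mod_cast h3
  have h6 : 0 < z := by exact_mod_cast h4
  omega

theorem c_gen {n : ℕ} (hn : 2 ≤ n) :
    ∃ S : Finset (Tn n), S.card = n + 1 ∧
      Subgroup.closure (S : Set (Tn n)) = ⊤ ∧
      (∀ c₀ : Circle ≃ₜ Circle, ∀ hc₀ : c₀ ∈ TnSet n, IsCk n 0 c₀ →
        (⟨c₀, Subgroup.subset_closure hc₀⟩ : Tn n) ∈ S) ∧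
      (∀ k : ℕ, 1 ≤ k → ∀ ℓ : ℕ, 0 < ℓ → ℓ < k * (n - 1) + 1 →
        ∀ ck : Circle ≃ₜ Circle, ∀ hck : ck ∈ TnSet n, IsCk n k ck →
          wordLength (S : Set (Tn n))
            ((⟨ck, Subgroup.subset_closure hck⟩ : Tn n) ^ ℓ) < 3 * k + n) := by
  classical
  obtain ⟨X, hX⟩ := exists_X hn
  obtain ⟨c, hc, hc0⟩ := exists_c hn
  have hinj : Function.Injective X := by
    intro i j hij
    rcases lt_trichotomy i j with h | h | h
    · exact absurd hij (X_ne hn hX h)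
    · exact h
    · exact absurd hij.symm (X_ne hn hX h)
  set S : Finset (Tn n) := insert c ((Finset.range n).image X) with hSd
  have hS : ∀ i < n, X i ∈ (S : Set (Tn n)) := by
    intro i hi
    simp only [hSd, Finset.coe_insert, Set.mem_insert_iff, Finset.mem_coe, Finset.mem_image,
      Finset.mem_range]
    exact Or.inr ⟨i, hi, rfl⟩
  have hcS : c ∈ (S : Set (Tn n)) := by simp [hSd]
  refine ⟨S, ?_, generation hn hX hc hS hcS, ?_, ?_⟩
  · rw [hSd, Finset.card_insert_of_notMem, Finset.card_image_of_injective _ hinj,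
      Finset.card_range]
    intro h
    obtain ⟨j, -, hj⟩ := Finset.mem_image.1 h
    exact X_ne_c hn hX hc0 j hj.symm
  · intro c₀ hc₀ h
    have h1 : MT n ⟨c₀, Subgroup.subset_closure hc₀⟩ (PP n 1) ((PP n 1).rotate 1) := h.maps hn
    rw [MT.ext hn (chain_PP hn 1) h1 hc]
    exact hcS
  · intro k hk l h0 hl ck hck h
    have h1 : MT n ⟨ck, Subgroup.subset_closure hck⟩ (PP n (k + 1)) ((PP n (k + 1)).rotate 1) :=
      h.maps hn
    obtain ⟨g, hg, hw⟩ := rot_word hn hX hc hS hcS k l h0 (by rw [Nat.succ_mul]; omega)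
    rw [MT.ext hn (chain_PP hn (k + 1)) (h1.pow_rotate l) hg]
    have := hw.wordLength_le
    omega

/-- Let `n ≥ 2`.  There exists a finite generating set `Σ` of `T_n`
with `n+1` elements, containing `c_0`, such that for all integers `k ≥ 1` and `ℓ` with
`0 < ℓ < k(n-1)+1`, the word length of `c_k^ℓ` with respect to `Σ` satisfies
`|c_k^ℓ|_Σ < 3k + n`. -/
theorem ck_pow_word_length (n : ℕ) (hn : 2 ≤ n) :
    ∃ S : Finset (Tn n), S.card = n + 1 ∧
      Subgroup.closure (S : Set (Tn n)) = ⊤ ∧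
      (∀ c₀ : Circle ≃ₜ Circle, ∀ hc₀ : c₀ ∈ TnSet n, IsCk n 0 c₀ →
        (⟨c₀, Subgroup.subset_closure hc₀⟩ : Tn n) ∈ S) ∧
      (∀ k : ℕ, 1 ≤ k → ∀ ℓ : ℕ, 0 < ℓ → ℓ < k * (n - 1) + 1 →
        ∀ ck : Circle ≃ₜ Circle, ∀ hck : ck ∈ TnSet n, IsCk n k ck →
          wordLength (S : Set (Tn n))
            ((⟨ck, Subgroup.subset_closure hck⟩ : Tn n) ^ ℓ) < 3 * k + n) := by
  exact c_gen hn

end ThompsonPaper
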